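/- arXiv:1603.08845 — 4 statements merged into one kernel-verified Lean document; each statement's English description precedes it below -/
import Mathlib

section
/- Let A be a real symmetric n×n matrix, let I = [λ−η, λ+η] with η > 0, let z = λ + iη and R(z) = (A − zI)^{−1}. If Λ_I ≠ ∅, then Q_I ≤ (n|I|/|Λ_I|)² · ( (1/n) Σ_{k=1}^n (Im R_{kk}(z))² ), where |I| = 2η. -/
open Finset

open Matrix in
/-- The spectral decomposition of the resolvent at a point that is not an eigenvalue. -/
lemma inv_sub_smul_one_apply_eq_sum {ι : Type*} [Fintype ι] [DecidableEq ι]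
    (A : Matrix ι ι ℝ) (lam : ι → ℝ) (u : ι → ι → ℝ)
    (heig : ∀ k, A.mulVec (u k) = lam k • u k)
    (horth : ∀ j k, (∑ i, u j i * u k i) = if j = k then 1 else 0)
    (z : ℂ) (hz : ∀ j, (lam j : ℂ) - z ≠ 0) (k l : ι) :
    (A.map (fun x => (x : ℂ)) - z • (1 : Matrix ι ι ℂ))⁻¹ k l =
      ∑ j, (u j k : ℂ) * ((lam j : ℂ) - z)⁻¹ * u j l := by
  set U : Matrix ι ι ℂ := Matrix.of fun j i => (u j i : ℂ) with hU
  have hUU : U * Uᵀ = 1 := by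
    ext j k
    have h := congrArg (fun x : ℝ => (x : ℂ)) (horth j k)
    push_cast at h
    simpa [hU, Matrix.mul_apply, Matrix.one_apply, apply_ite] using h
  have hAU : A.map (fun x => (x : ℂ)) * Uᵀ = Uᵀ * diagonal fun j => (lam j : ℂ) := by
    ext i j
    have h := congrArg (fun x : ℝ => (x : ℂ)) (congrFun (heig j) i)
    simp only [Matrix.mulVec, dotProduct, Pi.smul_apply, smul_eq_mul] at h
    push_cast at h
    rw [mul_diagonal]
    simpa [hU, Matrix.mul_apply, mul_comm] using h
  have hshift : (A.map (fun x => (x : ℂ)) - z • (1 : Matrix ι ι ℂ)) * Uᵀ =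
      Uᵀ * diagonal fun j => (lam j : ℂ) - z := by
    rw [sub_mul, hAU]
    ext i j
    simp only [Matrix.sub_apply, mul_diagonal, smul_mul_assoc, one_mul, Matrix.smul_apply, smul_eq_mul]
    ring
  have hinv : (A.map (fun x => (x : ℂ)) - z • (1 : Matrix ι ι ℂ)) *
      (Uᵀ * diagonal (fun j => ((lam j : ℂ) - z)⁻¹) * U) = 1 := by
    rw [← mul_assoc, ← mul_assoc, hshift, mul_assoc Uᵀ, diagonal_mul_diagonal]
    simp [mul_inv_cancel₀ (hz _), mul_eq_one_comm.mp hUU]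
  rw [Matrix.inv_eq_right_inv hinv, Matrix.mul_apply]
  simp [mul_diagonal, hU]

/-- The imaginary part of the Stieltjes kernel is the Poisson kernel. -/
lemma im_inv_ofReal_sub (x lambda η : ℝ) :
    ((x : ℂ) - (lambda + η * Complex.I))⁻¹.im = η / ((x - lambda) ^ 2 + η ^ 2) := by
  simp [Complex.inv_im, Complex.normSq_apply, sq]

/-- The Poisson kernel is at least `1 / (2η)` on `[λ-η, λ+η]`. -/
lemma one_le_two_mul_poisson {x lambda η : ℝ} (hη : 0 < η)
    (hx : x ∈ Set.Icc (lambda - η) (lambda + η)) :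
    1 ≤ 2 * η * (η / ((x - lambda) ^ 2 + η ^ 2)) := by
  obtain ⟨h₁, h₂⟩ := hx
  rw [← mul_div_assoc, one_le_div (by positivity)]
  nlinarith

/-- The spectral mass at `e_k` of an interval is controlled by the resolvent entry. -/
lemma sum_sq_le_two_mul_im_resolvent {ι : Type*} [Fintype ι] [DecidableEq ι]
    (A : Matrix ι ι ℝ) (lam : ι → ℝ) (u : ι → ι → ℝ)
    (heig : ∀ k, A.mulVec (u k) = lam k • u k)
    (horth : ∀ j k, (∑ i, u j i * u k i) = if j = k then 1 else 0)
    {lambda η : ℝ} (hη : 0 < η) (Λ : Finset ι)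
    (hΛ : ∀ j ∈ Λ, lam j ∈ Set.Icc (lambda - η) (lambda + η)) (k : ι) :
    ∑ j ∈ Λ, (u j k) ^ 2 ≤ 2 * η *
      ((A.map (fun x => (x : ℂ)) -
        (lambda + η * Complex.I) • (1 : Matrix ι ι ℂ))⁻¹ k k).im := by
  have hz : ∀ j, (lam j : ℂ) - (lambda + η * Complex.I) ≠ 0 := fun j h => by
    have := congrArg Complex.im h
    simp [hη.ne'] at this
  have him : ∀ j, ((u j k : ℂ) * ((lam j : ℂ) - (lambda + η * Complex.I))⁻¹ * u j k).im =
      (u j k) ^ 2 * (η / ((lam j - lambda) ^ 2 + η ^ 2)) := fun j => by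
    rw [Complex.im_mul_ofReal, Complex.im_ofReal_mul, im_inv_ofReal_sub]
    ring
  rw [inv_sub_smul_one_apply_eq_sum A lam u heig horth _ hz, Complex.im_sum, mul_sum]
  simp only [him]
  calc ∑ j ∈ Λ, (u j k) ^ 2
      ≤ ∑ j ∈ Λ, 2 * η * ((u j k) ^ 2 * (η / ((lam j - lambda) ^ 2 + η ^ 2))) := by
        refine sum_le_sum fun j hj => ?_
        linarith [mul_le_mul_of_nonneg_left (one_le_two_mul_poisson hη (hΛ j hj))
          (sq_nonneg (u j k))]
    _ ≤ _ := sum_le_sum_of_subset_of_nonneg (subset_univ Λ) fun j _ _ => by positivity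

/-- Lemma 2.1: `Q_I ≤ (n|I|/|Λ_I|)² · (1/n) Σ_k (Im R_kk(z))²` for `I = [λ-η, λ+η]`,
`z = λ + iη`, `R(z) = (A - z)⁻¹`, where `Λ_I` is the set of indices of eigenvectors with
eigenvalue in `I`. -/
theorem stmt_2 (n : ℕ) (A : Matrix (Fin n) (Fin n) ℝ) (hA : A.IsSymm)
    (lam : Fin n → ℝ) (u : Fin n → Fin n → ℝ)
    (heig : ∀ k, A.mulVec (u k) = lam k • u k)
    (horth : ∀ j k, (∑ i, u j i * u k i) = if j = k then 1 else 0)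
    (lambda η : ℝ) (hη : 0 < η)
    (Λ : Finset (Fin n)) (hΛ : Λ = univ.filter fun k => lam k ∈ Set.Icc (lambda - η) (lambda + η))
    (hne : Λ.Nonempty)
    (R : Matrix (Fin n) (Fin n) ℂ)
    (hR : R = (A.map (fun x => (x : ℂ)) - (lambda + η * Complex.I) • (1 : Matrix (Fin n) (Fin n) ℂ))⁻¹) :
    (n : ℝ) * ∑ k, ((Λ.card : ℝ)⁻¹ * ∑ j ∈ Λ, (u j k) ^ 2) ^ 2 ≤
      ((n : ℝ) * (2 * η) / Λ.card) ^ 2 *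
        ((n : ℝ)⁻¹ * ∑ k, ((R k k).im) ^ 2) := by
  have hmass : ∀ k, ∑ j ∈ Λ, (u j k) ^ 2 ≤ 2 * η * (R k k).im := fun k => by
    rw [hR]
    exact sum_sq_le_two_mul_im_resolvent A lam u heig horth hη Λ (by simp [hΛ]) k
  have hn : (n : ℝ) ≠ 0 := by
    obtain ⟨j, -⟩ := hne
    exact_mod_cast j.pos.ne'
  calc (n : ℝ) * ∑ k, ((Λ.card : ℝ)⁻¹ * ∑ j ∈ Λ, (u j k) ^ 2) ^ 2
      ≤ (n : ℝ) * ∑ k, ((Λ.card : ℝ)⁻¹ * (2 * η * (R k k).im)) ^ 2 := by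
        gcongr with k
        exact hmass k
    _ = _ := by
        simp only [mul_pow, ← mul_sum]
        field_simp
end

section
/- Let 0 < α < 2, let n ≥ 1, and let P : {1,…,n} → [0,∞) satisfy Σ_{k=1}^n P(k) = 1. Set p = 2 − α/2 and q = p/(p−1) (so that, with ε = α/(4−α), εp = α/2, (1−ε)q = 2 and p/q = 1 − α/2). Then 1 ≤ ( n^{α/2 − 1} Σ_{k=1}^n P(k)^{α/2} )^{1/p} · ( n Σ_{k=1}^n P(k)² )^{1/q}. Consequently, n Σ_{k=1}^n P(k)² ≥ ( n^{α/2 − 1} Σ_{k=1}^n P(k)^{α/2} )^{−2/(2−α)}. -/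
open Finset

/-- Interpolation of the `ℓ¹` sum between the `ℓᵃ` and `ℓ²` sums, for `0 < a < 1`. -/
theorem sum_le_sum_rpow_mul_sum_sq {ι : Type*} (s : Finset ι) (P : ι → ℝ) (hP : ∀ k, 0 ≤ P k)
    {a p q : ℝ} (hpq : p.HolderConjugate q) (h : a / p + 2 / q = 1) :
    ∑ k ∈ s, P k ≤ (∑ k ∈ s, P k ^ a) ^ (1 / p) * (∑ k ∈ s, P k ^ 2) ^ (1 / q) := by
  have hp := hpq.ne_zero
  have hq := hpq.symm.ne_zero
  have key := Real.inner_le_Lp_mul_Lq_of_nonneg s (f := fun k => P k ^ (a / p))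
    (g := fun k => P k ^ (2 / q)) hpq
    (fun k _ => Real.rpow_nonneg (hP k) _) (fun k _ => Real.rpow_nonneg (hP k) _)
  have h₁ (k : ι) : P k ^ (a / p) * P k ^ (2 / q) = P k := by
    rw [← Real.rpow_add' (hP k) (by rw [h]; exact one_ne_zero), h, Real.rpow_one]
  have h₂ (k : ι) : (P k ^ (a / p)) ^ p = P k ^ a := by
    rw [← Real.rpow_mul (hP k), div_mul_cancel₀ a hp]
  have h₃ (k : ι) : (P k ^ (2 / q)) ^ q = P k ^ 2 := by
    rw [← Real.rpow_mul (hP k), div_mul_cancel₀ 2 hq, Real.rpow_two]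
  simpa only [h₁, h₂, h₃] using key

/-- A lower bound on `B` from a lower bound on a product of powers of `A` and `B`. -/
theorem rpow_neg_div_le_of_one_le_mul {A B x y : ℝ} (hA : 0 ≤ A) (hB : 0 ≤ B) (hx : 0 < x)
    (hy : 0 < y) (h : 1 ≤ A ^ x * B ^ y) : A ^ (-(x / y)) ≤ B := by
  have hA' : 0 < A := by
    refine hA.lt_of_ne' fun h0 => ?_
    rw [h0, Real.zero_rpow hx.ne', zero_mul] at h
    exact absurd h (by norm_num)
  have h' : A ^ (-x) ≤ B ^ y := by
    rw [Real.rpow_neg hA, inv_le_iff_one_le_mul₀' (Real.rpow_pos_of_pos hA' x)]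
    exact h
  rw [← neg_div, div_eq_mul_inv, Real.rpow_mul hA]
  exact (Real.rpow_inv_le_iff_of_pos (Real.rpow_nonneg hA _) hB hy).2 h'

theorem stmt_5 (α : ℝ) (hα : 0 < α) (hα2 : α < 2) (n : ℕ) (hn : 1 ≤ n)
    (P : Fin n → ℝ) (hP : ∀ k, 0 ≤ P k) (hPsum : ∑ k, P k = 1) :
    (1 : ℝ) ≤ ((n : ℝ) ^ (α / 2 - 1) * ∑ k, P k ^ (α / 2)) ^ (1 / (2 - α / 2)) *
        ((n : ℝ) * ∑ k, P k ^ 2) ^ (1 / ((2 - α / 2) / (2 - α / 2 - 1))) ∧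
      ((n : ℝ) ^ (α / 2 - 1) * ∑ k, P k ^ (α / 2)) ^ (-(2 / (2 - α))) ≤
        (n : ℝ) * ∑ k, P k ^ 2 := by
  have hn' : (0 : ℝ) < n := by exact_mod_cast hn
  have hp : 0 < 2 - α / 2 := by linarith
  have hp1 : 0 < 2 - α / 2 - 1 := by linarith
  have hα' : 0 < 2 - α := by linarith
  have hα4 : 0 < 4 - α := by linarith
  have hp_eq : 2 - α / 2 = (4 - α) / 2 := by ring
  have hp1_eq : 2 - α / 2 - 1 = (2 - α) / 2 := by ring
  have hpq : (2 - α / 2).HolderConjugate ((2 - α / 2) / (2 - α / 2 - 1)) :=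
    Real.HolderConjugate.conjExponent (by linarith)
  have hA : 0 ≤ ∑ k, P k ^ (α / 2) := sum_nonneg fun k _ => Real.rpow_nonneg (hP k) _
  have hB : 0 ≤ ∑ k, P k ^ 2 := sum_nonneg fun k _ => sq_nonneg _
  have hc : 0 ≤ (n : ℝ) ^ (α / 2 - 1) := Real.rpow_nonneg hn'.le _
  have holder := sum_le_sum_rpow_mul_sum_sq univ P hP (a := α / 2) hpq
    (by rw [hp1_eq, hp_eq]; field_simp; ring)
  rw [hPsum] at holder
  have hcancel : ((n : ℝ) ^ (α / 2 - 1)) ^ (1 / (2 - α / 2)) *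
      (n : ℝ) ^ (1 / ((2 - α / 2) / (2 - α / 2 - 1))) = 1 := by
    rw [← Real.rpow_mul hn'.le, ← Real.rpow_add hn']
    convert Real.rpow_zero (n : ℝ) using 2
    field_simp
    ring
  have main : (1 : ℝ) ≤ ((n : ℝ) ^ (α / 2 - 1) * ∑ k, P k ^ (α / 2)) ^ (1 / (2 - α / 2)) *
      ((n : ℝ) * ∑ k, P k ^ 2) ^ (1 / ((2 - α / 2) / (2 - α / 2 - 1))) := by
    rwa [Real.mul_rpow hc hA, Real.mul_rpow hn'.le hB, mul_mul_mul_comm, hcancel, one_mul]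
  refine ⟨main, ?_⟩
  have hexp : 2 / (2 - α) =
      1 / (2 - α / 2) / (1 / ((2 - α / 2) / (2 - α / 2 - 1))) := by
    rw [hp1_eq, hp_eq]
    field_simp
  rw [hexp]
  exact rpow_neg_div_le_of_one_le_mul (mul_nonneg hc hA) (mul_nonneg hn'.le hB)
    (by positivity) (by positivity) main
end

section
/- Let h ∈ ℂ with Re(h) ≥ 0 and let 0 < β < 1. Then Re(h^β) ≥ (Re h)^β, where h^β denotes the principal branch of the complex power (with argument taken in (−π, π]). -/
/-- On `[-π/2, π/2]`, the weighted AM-GM inequality and concavity of the cosine compare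
`cos θ ^ β` with `cos (θ * β)`. -/
theorem Real.cos_rpow_le_cos_mul {θ β : ℝ} (hθ : θ ∈ Set.Icc (-(Real.pi / 2)) (Real.pi / 2))
    (hβ : 0 ≤ β) (hβ1 : β ≤ 1) : Real.cos θ ^ β ≤ Real.cos (θ * β) := by
  have hpi := Real.pi_pos
  have hamgm := Real.geom_mean_le_arith_mean2_weighted hβ (sub_nonneg.2 hβ1)
    (Real.cos_nonneg_of_mem_Icc hθ) zero_le_one (by ring)
  have hconc := strictConcaveOn_cos_Icc.concaveOn.2 hθ
    (show (0 : ℝ) ∈ Set.Icc (-(Real.pi / 2)) (Real.pi / 2) by constructor <;> linarith)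
    hβ (sub_nonneg.2 hβ1) (by ring)
  simp only [Real.one_rpow, mul_one, smul_eq_mul, mul_zero, add_zero, Real.cos_zero]
    at hamgm hconc
  rw [mul_comm θ β]
  exact hamgm.trans hconc

theorem stmt_6 (h : ℂ) (hre : 0 ≤ h.re) (β : ℝ) (hβ : 0 < β) (hβ1 : β < 1) :
    h.re ^ β ≤ (h ^ (β : ℂ)).re := by
  have harg : h.arg ∈ Set.Icc (-(Real.pi / 2)) (Real.pi / 2) :=
    abs_le.1 (Complex.abs_arg_le_pi_div_two_iff.2 hre)
  rw [Complex.cpow_ofReal_re, ← Complex.norm_mul_cos_arg h,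
    Real.mul_rpow (norm_nonneg h) (Real.cos_nonneg_of_mem_Icc harg)]
  gcongr
  exact Real.cos_rpow_le_cos_mul harg hβ.le hβ1.le
end

section
/- Let β ∈ (0,2), β ≠ 1. There exists a constant C > 0 such that for all 0 ≤ ω < ψ ≤ π/2, the kernel k(ω, ψ) = sin(ψ − ω)^{β−1} ∫_ψ^{π/2} (sin 2θ)^{β/2 − 1} sin(θ − ψ)^{−β/2} sin(θ − ω)^{−β/2} dθ satisfies: if 0 < β < 1, then k(ω, ψ) ≤ C (ψ − ω)^{β−1} ( min(sin 2ψ, sin 2ω) )^{−β/2}; and if 1 < β < 2, then k(ω, ψ) ≤ C ( min(sin 2ψ, sin 2ω) )^{β/2 − 1}. -/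
open MeasureTheory Real intervalIntegral

/-- The function `t ↦ t ^ (-p)` on `t ≤ 1`, continued by `t ↦ t ^ (-q)` on `t > 1`. -/
noncomputable def brokenPower (p q t : ℝ) : ℝ := if t ≤ 1 then t ^ (-p) else t ^ (-q)

lemma brokenPower_nonneg (p q : ℝ) {t : ℝ} (ht : 0 ≤ t) : 0 ≤ brokenPower p q t := by
  unfold brokenPower
  split_ifs <;> positivity

lemma integrableOn_brokenPower {p q : ℝ} (hp : p < 1) (hq : 1 < q) :
    IntegrableOn (brokenPower p q) (Set.Ioi 0) := by
  rw [← Set.Ioc_union_Ioi_eq_Ioi (zero_le_one (α := ℝ))]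
  refine IntegrableOn.union ?_ ?_
  · have h : IntegrableOn (fun t : ℝ => t ^ (-p)) (Set.Ioc 0 1) :=
      (intervalIntegrable_iff_integrableOn_Ioc_of_le zero_le_one).1
        (intervalIntegrable_rpow' (by linarith))
    exact h.congr_fun (fun t ht => by simp [brokenPower, ht.2]) measurableSet_Ioc
  · have h : IntegrableOn (fun t : ℝ => t ^ (-q)) (Set.Ioi 1) :=
      integrableOn_Ioi_rpow_of_lt (by linarith) one_pos
    exact h.congr_fun (fun t ht => by simp [brokenPower, not_le.2 (Set.mem_Ioi.1 ht)])
      measurableSet_Ioi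

/-- A function dominated by a rescaled broken power plus an endpoint power has an explicitly
bounded integral. -/
lemma integral_le_of_le_brokenPower_add {p q a L d A B : ℝ} {F : ℝ → ℝ} (hp : p < 1) (hq : 1 < q)
    (ha : 0 < a) (hL : 0 < L) (hd : 0 < d) (hA : 0 ≤ A)
    (hF0 : ∀ t ∈ Set.Ioo 0 L, 0 ≤ F t)
    (hF : ∀ t ∈ Set.Ioo 0 L, F t ≤ A * brokenPower p q (d⁻¹ * t) + B * (L - t) ^ (a - 1)) :
    ∫ t in (0 : ℝ)..L, F t ≤
      A * (d * ∫ t in Set.Ioi 0, brokenPower p q t) + B * (L ^ a / a) := by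
  have hd' : 0 < d⁻¹ := inv_pos.2 hd
  have i1 : IntegrableOn (fun t => brokenPower p q (d⁻¹ * t)) (Set.Ioi 0) := by
    rw [integrableOn_Ioi_comp_mul_left_iff _ _ hd', mul_zero]
    exact integrableOn_brokenPower hp hq
  have i1' : IntegrableOn (fun t => brokenPower p q (d⁻¹ * t)) (Set.Ioo 0 L) :=
    i1.mono_set Set.Ioo_subset_Ioi_self
  have i2 : IntervalIntegrable (fun t : ℝ => (L - t) ^ (a - 1)) volume 0 L := by
    have := (intervalIntegrable_rpow' (a := 0) (b := L) (r := a - 1)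
      (by linarith)).comp_sub_left L
    simpa using this.symm
  have i2' : IntegrableOn (fun t : ℝ => (L - t) ^ (a - 1)) (Set.Ioo 0 L) :=
    ((intervalIntegrable_iff_integrableOn_Ioc_of_le hL.le).1 i2).mono_set Set.Ioo_subset_Ioc_self
  have e2 : ∫ t in Set.Ioo 0 L, (L - t) ^ (a - 1) = L ^ a / a := by
    rw [← integral_Ioc_eq_integral_Ioo, ← intervalIntegral.integral_of_le hL.le,
      intervalIntegral.integral_comp_sub_left (fun x : ℝ => x ^ (a - 1)) L,
      integral_rpow (Or.inl (by linarith))]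
    simp [Real.zero_rpow ha.ne']
  have e1 : ∫ t in Set.Ioo 0 L, brokenPower p q (d⁻¹ * t) ≤
      d * ∫ t in Set.Ioi 0, brokenPower p q t := by
    have h := integral_comp_mul_left_Ioi (brokenPower p q) 0 hd'
    rw [mul_zero, inv_inv, smul_eq_mul] at h
    rw [← h]
    refine setIntegral_mono_set i1 ?_ Set.Ioo_subset_Ioi_self.eventuallyLE
    filter_upwards [ae_restrict_mem measurableSet_Ioi] with t ht
    exact brokenPower_nonneg p q (mul_nonneg hd'.le (Set.mem_Ioi.1 ht).le)
  rw [intervalIntegral.integral_of_le hL.le, integral_Ioc_eq_integral_Ioo]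
  calc ∫ t in Set.Ioo 0 L, F t
      ≤ ∫ t in Set.Ioo 0 L, (A * brokenPower p q (d⁻¹ * t) + B * (L - t) ^ (a - 1)) := by
        refine integral_mono_of_nonneg ?_ ((i1'.const_mul A).add (i2'.const_mul B)) ?_
        · filter_upwards [ae_restrict_mem measurableSet_Ioo] with t ht using hF0 t ht
        · filter_upwards [ae_restrict_mem measurableSet_Ioo] with t ht using hF t ht
    _ = A * (∫ t in Set.Ioo 0 L, brokenPower p q (d⁻¹ * t)) + B * (L ^ a / a) := by
        rw [integral_add (i1'.const_mul A) (i2'.const_mul B),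
          MeasureTheory.integral_const_mul, MeasureTheory.integral_const_mul, e2]
    _ ≤ _ := by gcongr

lemma half_le_sin {x : ℝ} (h0 : 0 ≤ x) (h1 : x ≤ π / 2) : x / 2 ≤ sin x := by
  refine le_trans ?_ (Real.mul_le_sin h0 h1)
  rw [div_mul_eq_mul_div, div_le_div_iff₀ two_pos pi_pos]
  nlinarith [pi_le_four]

lemma min_le_sin_two_mul {x : ℝ} (h0 : 0 ≤ x) (h1 : x ≤ π / 2) :
    min x (π / 2 - x) ≤ sin (2 * x) := by
  rcases le_total x (π / 4) with h | h
  · exact (min_le_left _ _).trans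
      (by linarith [half_le_sin (x := 2 * x) (by linarith) (by linarith)])
  · rw [← Real.sin_pi_sub]
    exact (min_le_right _ _).trans
      (by linarith [half_le_sin (x := π - 2 * x) (by linarith) (by linarith)])

lemma sin_two_mul_le_two_mul_min {x : ℝ} (h0 : 0 ≤ x) (h1 : x ≤ π / 2) :
    sin (2 * x) ≤ 2 * min x (π / 2 - x) := by
  rcases min_choice x (π / 2 - x) with h | h <;> rw [h]
  · exact Real.sin_le (by linarith)
  · rw [← Real.sin_pi_sub]
    linarith [Real.sin_le (x := π - 2 * x) (by linarith)]

lemma sin_rpow_neg_le {x a : ℝ} (h0 : 0 < x) (h1 : x ≤ π / 2) (ha0 : 0 ≤ a) (ha1 : a ≤ 1) :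
    sin x ^ (-a) ≤ 2 * x ^ (-a) := by
  calc sin x ^ (-a) ≤ (x / 2) ^ (-a) :=
        Real.rpow_le_rpow_of_nonpos (by linarith) (half_le_sin h0.le h1) (by linarith)
    _ = 2 ^ a * x ^ (-a) := by
        rw [Real.div_rpow h0.le two_pos.le, Real.rpow_neg two_pos.le, div_inv_eq_mul, mul_comm]
    _ ≤ 2 * x ^ (-a) := by
        gcongr
        exact Real.rpow_le_self_of_one_le one_le_two ha1

lemma inv_mul_rpow_neg {d t : ℝ} (hd : 0 < d) (ht : 0 ≤ t) (p : ℝ) :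
    (d⁻¹ * t) ^ (-p) = d ^ p * t ^ (-p) := by
  rw [Real.mul_rpow (by positivity) ht, Real.inv_rpow hd.le, Real.rpow_neg hd.le, inv_inv]

/-- Pointwise bound on the integrand of the kernel, shifted to start at `0`, with every sine
replaced by a piecewise linear lower bound. -/
lemma kernel_integrand_le {a ω ψ t : ℝ} (ha0 : 0 < a) (ha1 : a < 1) (hω : 0 ≤ ω) (hωψ : ω < ψ)
    (ht : t ∈ Set.Ioo 0 (π / 2 - ψ)) :
    sin (2 * (t + ψ)) ^ (a - 1) * sin t ^ (-a) * sin (t + (ψ - ω)) ^ (-a) ≤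
      4 * (min (t + ψ) (π / 2 - ψ - t) ^ (a - 1) * (t ^ (-a) * (t + (ψ - ω)) ^ (-a))) := by
  obtain ⟨h0, h1⟩ := ht
  have e : π / 2 - ψ - t = π / 2 - (t + ψ) := by ring
  have hm : 0 < min (t + ψ) (π / 2 - (t + ψ)) := lt_min (by linarith) (by linarith)
  have b1 : sin (2 * (t + ψ)) ^ (a - 1) ≤ min (t + ψ) (π / 2 - ψ - t) ^ (a - 1) := by
    rw [e]
    exact Real.rpow_le_rpow_of_nonpos hm (min_le_sin_two_mul (by linarith) (by linarith))
      (by linarith)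
  have b2 := sin_rpow_neg_le (x := t) h0 (by linarith) ha0.le ha1.le
  have b3 := sin_rpow_neg_le (x := t + (ψ - ω)) (by linarith) (by linarith) ha0.le ha1.le
  have s1 : 0 ≤ sin t := Real.sin_nonneg_of_nonneg_of_le_pi h0.le (by linarith)
  have s2 : 0 ≤ sin (t + (ψ - ω)) :=
    Real.sin_nonneg_of_nonneg_of_le_pi (by linarith) (by linarith)
  have s3 : 0 ≤ min (t + ψ) (π / 2 - ψ - t) := by rw [e]; exact hm.le
  calc _ ≤ min (t + ψ) (π / 2 - ψ - t) ^ (a - 1) * (2 * t ^ (-a)) *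
          (2 * (t + (ψ - ω)) ^ (-a)) := by gcongr
    _ = _ := by ring

lemma kernel_integrand_nonneg {a ω ψ t : ℝ} (hω : 0 ≤ ω) (hωψ : ω < ψ)
    (ht : t ∈ Set.Ioo 0 (π / 2 - ψ)) :
    0 ≤ sin (2 * (t + ψ)) ^ (a - 1) * sin t ^ (-a) * sin (t + (ψ - ω)) ^ (-a) := by
  obtain ⟨h0, h1⟩ := ht
  have s0 : 0 ≤ sin (2 * (t + ψ)) :=
    Real.sin_nonneg_of_nonneg_of_le_pi (by linarith) (by linarith)
  have s1 : 0 ≤ sin t := Real.sin_nonneg_of_nonneg_of_le_pi h0.le (by linarith)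
  have s2 : 0 ≤ sin (t + (ψ - ω)) :=
    Real.sin_nonneg_of_nonneg_of_le_pi (by linarith) (by linarith)
  positivity

/-- The piecewise linear bound on the right half of the interval. -/
lemma min_rpow_mul_le_right {a ψ L δ t : ℝ} (ha0 : 0 < a) (hψ : 0 < ψ) (hδ : 0 < δ)
    (hL : 0 < L) (hLt : L / 2 < t) (htL : t < L) :
    min (t + ψ) (L - t) ^ (a - 1) * (t ^ (-a) * (t + δ) ^ (-a)) ≤
      (L / 2) ^ (-a) * (L / 2 + δ) ^ (-a) * (L - t) ^ (a - 1) := by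
  rw [min_eq_right (by linarith), mul_comm]
  have := Real.rpow_le_rpow_of_nonpos (z := -a) (half_pos hL) hLt.le (by linarith)
  have := Real.rpow_le_rpow_of_nonpos (x := L / 2 + δ) (y := t + δ) (z := -a) (by linarith)
    (by linarith) (by linarith)
  have : 0 ≤ L - t := by linarith
  have : 0 ≤ t := by linarith
  have : 0 ≤ t + δ := by linarith
  gcongr

lemma min_rpow_mul_le_left_of_lt_half {a ψ L δ r t : ℝ} (ha0 : 0 < a) (ha1 : a < 1)
    (hψ : 0 < ψ) (hδ : 0 < δ) (hr : 0 < r) (hrψ : r ≤ ψ) (hrL : r ≤ L / 2)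
    (h0 : 0 < t) (hLt : t ≤ L / 2) :
    min (t + ψ) (L - t) ^ (a - 1) * (t ^ (-a) * (t + δ) ^ (-a)) ≤
      r ^ (-a - 1) * brokenPower (2 * a) (1 + a) (r⁻¹ * t) := by
  have hJ := Real.rpow_le_rpow_of_nonpos (x := t) (y := t + δ) (z := -a) h0 (by linarith)
    (by linarith)
  have hmax : max r t ≤ min (t + ψ) (L - t) :=
    max_le (le_min (by linarith) (by linarith)) (le_min (by linarith) (by linarith))
  have hm := Real.rpow_le_rpow_of_nonpos (z := a - 1) (lt_max_of_lt_left hr) hmax (by linarith)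
  have hmax0 : 0 < max r t := lt_max_of_lt_left hr
  calc _ ≤ max r t ^ (a - 1) * (t ^ (-a) * t ^ (-a)) := by gcongr
    _ = _ := by
      unfold brokenPower
      simp only [inv_mul_le_one₀ hr]
      rw [inv_mul_rpow_neg hr h0.le, inv_mul_rpow_neg hr h0.le]
      split_ifs with h
      · rw [max_eq_left h, ← mul_assoc, ← mul_assoc, ← Real.rpow_add hr, mul_assoc,
          ← Real.rpow_add h0]
        ring_nf
      · rw [max_eq_right (not_le.1 h).le, ← mul_assoc, ← mul_assoc, ← Real.rpow_add h0,
          ← Real.rpow_add h0, ← Real.rpow_add hr]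
        ring_nf
        simp

lemma min_rpow_mul_le_left_of_half_lt {a ψ L δ r t : ℝ} (ha0 : 0 < a) (ha1 : a < 1)
    (hδ : 0 < δ) (hr : 0 < r) (hrψ : r ≤ ψ) (hrL : r ≤ L / 2)
    (h0 : 0 < t) (hLt : t ≤ L / 2) :
    min (t + ψ) (L - t) ^ (a - 1) * (t ^ (-a) * (t + δ) ^ (-a)) ≤
      r ^ (a - 1) * δ ^ (-(2 * a)) * brokenPower a (2 * a) (δ⁻¹ * t) := by
  have hJ := Real.rpow_le_rpow_of_nonpos (x := max δ t) (y := t + δ) (z := -a)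
    (lt_max_of_lt_left hδ) (max_le (by linarith) (by linarith)) (by linarith)
  have hm := Real.rpow_le_rpow_of_nonpos (y := min (t + ψ) (L - t)) (z := a - 1) hr
    (le_min (by linarith) (by linarith)) (by linarith)
  have hmax0 : 0 < max δ t := lt_max_of_lt_left hδ
  have htδ : 0 ≤ t + δ := by linarith
  rw [mul_assoc]
  calc _ ≤ r ^ (a - 1) * (t ^ (-a) * max δ t ^ (-a)) := by gcongr
    _ = _ := by
      congr 1
      unfold brokenPower
      simp only [inv_mul_le_one₀ hδ]
      rw [inv_mul_rpow_neg hδ h0.le, inv_mul_rpow_neg hδ h0.le]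
      split_ifs with h
      · rw [max_eq_left h, ← mul_assoc, ← Real.rpow_add hδ, mul_comm]
        ring_nf
      · rw [max_eq_right (not_le.1 h).le, ← mul_assoc, ← Real.rpow_add h0, ← Real.rpow_add hδ]
        ring_nf
        simp

/-- The kernel integral after shifting the variable to start at `0`. -/
lemma kernel_integral_shift (a ω ψ : ℝ) :
    ∫ θ in ψ..(π / 2), (sin (2 * θ)) ^ (a - 1) * sin (θ - ψ) ^ (-a) * sin (θ - ω) ^ (-a) =
      ∫ t in (0 : ℝ)..(π / 2 - ψ),
        sin (2 * (t + ψ)) ^ (a - 1) * sin t ^ (-a) * sin (t + (ψ - ω)) ^ (-a) := by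
  have h := intervalIntegral.integral_comp_sub_right (a := ψ) (b := π / 2)
    (fun t => sin (2 * (t + ψ)) ^ (a - 1) * sin t ^ (-a) * sin (t + (ψ - ω)) ^ (-a)) ψ
  simpa using h

/-- If the left half of the shifted integrand is dominated by a rescaled broken power, then the
kernel integral is controlled. -/
lemma kernel_integral_le {a ω ψ p q A d : ℝ} (ha0 : 0 < a) (ha1 : a < 1) (hp : p < 1) (hq : 1 < q)
    (hω : 0 ≤ ω) (hωψ : ω < ψ) (hψ : ψ < π / 2) (hA : 0 ≤ A) (hd : 0 < d)
    (hleft : ∀ t, 0 < t → t ≤ (π / 2 - ψ) / 2 →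
      min (t + ψ) (π / 2 - ψ - t) ^ (a - 1) * (t ^ (-a) * (t + (ψ - ω)) ^ (-a)) ≤
        A * brokenPower p q (d⁻¹ * t)) :
    ∫ θ in ψ..(π / 2), (sin (2 * θ)) ^ (a - 1) * sin (θ - ψ) ^ (-a) * sin (θ - ω) ^ (-a) ≤
      4 * (A * (d * ∫ t in Set.Ioi 0, brokenPower p q t) +
        2 / a * ((π / 2 - ψ) / 2 + (ψ - ω)) ^ (-a)) := by
  rw [kernel_integral_shift]
  set L := π / 2 - ψ with hL
  have hL0 : 0 < L := by linarith
  have hδ : 0 < ψ - ω := by linarith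
  set B := (L / 2) ^ (-a) * (L / 2 + (ψ - ω)) ^ (-a) with hB
  have hB0 : 0 ≤ B := by positivity
  have key := integral_le_of_le_brokenPower_add (A := 4 * A) (B := 4 * B) hp hq ha0 hL0 hd
    (by positivity) (fun t ht => kernel_integrand_nonneg (a := a) hω hωψ ht)
    (fun t ht => by
      refine (kernel_integrand_le ha0 ha1 hω hωψ ht).trans ?_
      have ht0 : 0 < t := ht.1
      have htL : 0 ≤ L - t := by linarith [ht.2]
      rw [mul_assoc, mul_assoc, ← mul_add]
      refine mul_le_mul_of_nonneg_left ?_ (by norm_num)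
      rcases le_or_gt t (L / 2) with h | h
      · exact (hleft t ht.1 h).trans (le_add_of_nonneg_right (by positivity))
      · refine (min_rpow_mul_le_right ha0 (by linarith) hδ hL0 h ht.2).trans
          (le_add_of_nonneg_left (mul_nonneg hA (brokenPower_nonneg _ _ (by positivity)))))
  refine key.trans ?_
  rw [mul_assoc, mul_assoc, ← mul_add]
  have hLa : (L / 2) ^ (-a) * L ^ a ≤ 2 := by
    rw [Real.div_rpow hL0.le two_pos.le, Real.rpow_neg two_pos.le, div_inv_eq_mul,
      mul_right_comm, ← Real.rpow_add hL0, neg_add_cancel, Real.rpow_zero, one_mul]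
    exact Real.rpow_le_self_of_one_le one_le_two ha1.le
  gcongr 4 * (_ + ?_)
  calc B * (L ^ a / a)
      = ((L / 2) ^ (-a) * L ^ a) * (L / 2 + (ψ - ω)) ^ (-a) / a := by rw [hB]; ring
    _ ≤ 2 * (L / 2 + (ψ - ω)) ^ (-a) / a := by gcongr
    _ = _ := by ring

lemma rpow_neg_le_four_mul {m r a : ℝ} (hm : 0 < m) (hr : m / 4 ≤ r) (ha0 : 0 ≤ a)
    (ha1 : a ≤ 1) : r ^ (-a) ≤ 4 * m ^ (-a) := by
  calc r ^ (-a) ≤ (m / 4) ^ (-a) :=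
        Real.rpow_le_rpow_of_nonpos (by linarith) hr (by linarith)
    _ = 4 ^ a * m ^ (-a) := by
        rw [Real.div_rpow hm.le (by norm_num), Real.rpow_neg (x := 4) (by norm_num),
          div_inv_eq_mul, mul_comm]
    _ ≤ 4 * m ^ (-a) := by
        gcongr
        exact Real.rpow_le_self_of_one_le (by norm_num) ha1

lemma kernel_le_of_lt_half {a : ℝ} (ha0 : 0 < a) (ha1 : a < 1 / 2) :
    ∃ C : ℝ, 0 < C ∧ ∀ ω ψ m : ℝ, 0 ≤ ω → ω < ψ → ψ < π / 2 → 0 < m → m ≤ sin (2 * ψ) →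
      sin (ψ - ω) ^ (2 * a - 1) *
        (∫ θ in ψ..(π / 2), (sin (2 * θ)) ^ (a - 1) * sin (θ - ψ) ^ (-a) * sin (θ - ω) ^ (-a)) ≤
      C * (ψ - ω) ^ (2 * a - 1) * m ^ (-a) := by
  have hK : 0 ≤ ∫ t in Set.Ioi 0, brokenPower (2 * a) (1 + a) t :=
    setIntegral_nonneg measurableSet_Ioi fun t ht => brokenPower_nonneg _ _ (Set.mem_Ioi.1 ht).le
  refine ⟨2 * (4 * ((∫ t in Set.Ioi 0, brokenPower (2 * a) (1 + a) t) + 2 / a) * 4),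
    by positivity, fun ω ψ m hω hωψ hψ hm hmψ => ?_⟩
  set K := ∫ t in Set.Ioi 0, brokenPower (2 * a) (1 + a) t
  have hs := sin_two_mul_le_two_mul_min (x := ψ) (by linarith) hψ.le
  set r := min ψ (π / 2 - ψ) / 2 with hr
  have hr0 : 0 < r := by linarith
  have hrψ : r ≤ ψ := by linarith [min_le_left ψ (π / 2 - ψ)]
  have hrL : r ≤ (π / 2 - ψ) / 2 := by linarith [min_le_right ψ (π / 2 - ψ)]
  have hδ : 0 < ψ - ω := by linarith
  have hI := kernel_integral_le ha0 (by linarith) (by linarith) (by linarith) hω hωψ hψ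
    (by positivity) hr0 (fun t h0 ht => min_rpow_mul_le_left_of_lt_half ha0 (by linarith)
      (by linarith) hδ hr0 hrψ hrL h0 ht)
  have hr1 : r ^ (-a - 1) * (r * K) = r ^ (-a) * K := by
    rw [← mul_assoc, ← Real.rpow_add_one hr0.ne', sub_add_cancel]
  have hr2 := Real.rpow_le_rpow_of_nonpos (x := r) (y := (π / 2 - ψ) / 2 + (ψ - ω)) (z := -a) hr0
    (by linarith) (by linarith)
  have hr3 := rpow_neg_le_four_mul (m := m) (r := r) (a := a) hm (by linarith) ha0.le (by linarith)
  have hI' : (∫ θ in ψ..(π / 2), (sin (2 * θ)) ^ (a - 1) * sin (θ - ψ) ^ (-a) *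
      sin (θ - ω) ^ (-a)) ≤ 4 * (K + 2 / a) * (4 * m ^ (-a)) := by
    refine hI.trans ?_
    calc _ ≤ 4 * (r ^ (-a) * K + 2 / a * r ^ (-a)) := by rw [hr1]; gcongr
      _ = 4 * (K + 2 / a) * r ^ (-a) := by ring
      _ ≤ _ := by gcongr
  have hsin : sin (ψ - ω) ^ (2 * a - 1) ≤ 2 * (ψ - ω) ^ (2 * a - 1) := by
    have := sin_rpow_neg_le (x := ψ - ω) (a := 1 - 2 * a) hδ (by linarith) (by linarith)
      (by linarith)
    rwa [neg_sub] at this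
  have hs0 : 0 ≤ sin (ψ - ω) := Real.sin_nonneg_of_nonneg_of_le_pi hδ.le (by linarith)
  calc _ ≤ sin (ψ - ω) ^ (2 * a - 1) * (4 * (K + 2 / a) * (4 * m ^ (-a))) := by gcongr
    _ ≤ 2 * (ψ - ω) ^ (2 * a - 1) * (4 * (K + 2 / a) * (4 * m ^ (-a))) := by gcongr
    _ = _ := by ring

lemma kernel_le_of_half_lt {a : ℝ} (ha0 : 1 / 2 < a) (ha1 : a < 1) :
    ∃ C : ℝ, 0 < C ∧ ∀ ω ψ m : ℝ, 0 ≤ ω → ω < ψ → ψ < π / 2 → 0 < m → m ≤ sin (2 * ψ) →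
      sin (ψ - ω) ^ (2 * a - 1) *
        (∫ θ in ψ..(π / 2), (sin (2 * θ)) ^ (a - 1) * sin (θ - ψ) ^ (-a) * sin (θ - ω) ^ (-a)) ≤
      C * m ^ (a - 1) := by
  have ha : 0 < a := by linarith
  have hK : 0 ≤ ∫ t in Set.Ioi 0, brokenPower a (2 * a) t :=
    setIntegral_nonneg measurableSet_Ioi fun t ht => brokenPower_nonneg _ _ (Set.mem_Ioi.1 ht).le
  refine ⟨4 * ((∫ t in Set.Ioi 0, brokenPower a (2 * a) t) + 2 / a) * 4,
    by positivity, fun ω ψ m hω hωψ hψ hm hmψ => ?_⟩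
  set K := ∫ t in Set.Ioi 0, brokenPower a (2 * a) t
  have hs := sin_two_mul_le_two_mul_min (x := ψ) (by linarith) hψ.le
  set r := min ψ (π / 2 - ψ) / 2 with hr
  have hr0 : 0 < r := by linarith
  have hrψ : r ≤ ψ := by linarith [min_le_left ψ (π / 2 - ψ)]
  have hrL : r ≤ (π / 2 - ψ) / 2 := by linarith [min_le_right ψ (π / 2 - ψ)]
  have hδ : 0 < ψ - ω := by linarith
  have hI := kernel_integral_le ha ha1 ha1 (by linarith) hω hωψ hψ
    (by positivity) hδ (fun t h0 ht => min_rpow_mul_le_left_of_half_lt ha ha1 hδ hr0 hrψ hrL h0 ht)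
  set δ := ψ - ω with hδdef
  set M := (π / 2 - ψ) / 2 + δ with hM
  have hM0 : 0 < M := by linarith
  have hδ1 : δ ^ (2 * a - 1) * (δ ^ (-(2 * a)) * δ) = 1 := by
    rw [← Real.rpow_add_one hδ.ne', ← Real.rpow_add hδ]
    ring_nf
    simp
  have hM1 : δ ^ (2 * a - 1) * M ^ (-a) ≤ r ^ (a - 1) := by
    calc δ ^ (2 * a - 1) * M ^ (-a) ≤ M ^ (2 * a - 1) * M ^ (-a) := by
          gcongr <;> linarith
      _ = M ^ (a - 1) := by rw [← Real.rpow_add hM0]; ring_nf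
      _ ≤ r ^ (a - 1) := Real.rpow_le_rpow_of_nonpos hr0 (by linarith) (by linarith)
  have hr3 : r ^ (a - 1) ≤ 4 * m ^ (a - 1) := by
    have := rpow_neg_le_four_mul (m := m) (r := r) (a := 1 - a) hm (by linarith) (by linarith)
      (by linarith)
    rwa [neg_sub] at this
  have hs0 : 0 ≤ sin δ := Real.sin_nonneg_of_nonneg_of_le_pi hδ.le (by linarith)
  have hsin : sin δ ^ (2 * a - 1) ≤ δ ^ (2 * a - 1) :=
    Real.rpow_le_rpow hs0 (Real.sin_le hδ.le) (by linarith)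
  calc _ ≤ sin δ ^ (2 * a - 1) *
        (4 * (r ^ (a - 1) * δ ^ (-(2 * a)) * (δ * K) + 2 / a * M ^ (-a))) := by gcongr
    _ ≤ δ ^ (2 * a - 1) *
        (4 * (r ^ (a - 1) * δ ^ (-(2 * a)) * (δ * K) + 2 / a * M ^ (-a))) := by gcongr
    _ = 4 * ((δ ^ (2 * a - 1) * (δ ^ (-(2 * a)) * δ)) * K * r ^ (a - 1) +
        2 / a * (δ ^ (2 * a - 1) * M ^ (-a))) := by ring
    _ ≤ 4 * (1 * K * r ^ (a - 1) + 2 / a * r ^ (a - 1)) := by rw [hδ1]; gcongr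
    _ = 4 * (K + 2 / a) * r ^ (a - 1) := by ring
    _ ≤ 4 * (K + 2 / a) * (4 * m ^ (a - 1)) := by gcongr
    _ = _ := by ring

/-- Bounds on the kernel
`k(ω,ψ) = sin(ψ-ω)^{β-1} ∫_ψ^{π/2} (sin 2θ)^{β/2-1} sin(θ-ψ)^{-β/2} sin(θ-ω)^{-β/2} dθ`,
stated in `ℝ≥0∞` so that `min(sin 2ψ, sin 2ω)^{-β/2}` is `∞` when the minimum vanishes. -/
theorem stmt_14 (β : ℝ) (hβ0 : 0 < β) (hβ2 : β < 2) (hβ1 : β ≠ 1) :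
    ∃ C : ℝ, 0 < C ∧
      ∀ ω ψ : ℝ, 0 ≤ ω → ω < ψ → ψ ≤ π / 2 →
        ((β < 1 →
          ENNReal.ofReal (Real.sin (ψ - ω) ^ (β - 1) *
              ∫ θ in ψ..(π / 2), (Real.sin (2 * θ)) ^ (β / 2 - 1) *
                Real.sin (θ - ψ) ^ (-(β / 2)) * Real.sin (θ - ω) ^ (-(β / 2))) ≤
            ENNReal.ofReal C * ENNReal.ofReal (ψ - ω) ^ (β - 1) *
              ENNReal.ofReal (min (Real.sin (2 * ψ)) (Real.sin (2 * ω))) ^ (-(β / 2))) ∧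
        (1 < β →
          ENNReal.ofReal (Real.sin (ψ - ω) ^ (β - 1) *
              ∫ θ in ψ..(π / 2), (Real.sin (2 * θ)) ^ (β / 2 - 1) *
                Real.sin (θ - ψ) ^ (-(β / 2)) * Real.sin (θ - ω) ^ (-(β / 2))) ≤
            ENNReal.ofReal C *
              ENNReal.ofReal (min (Real.sin (2 * ψ)) (Real.sin (2 * ω))) ^ (β / 2 - 1))) := by
  have hsin_min : ∀ ω ψ : ℝ, 0 ≤ ω → ω < ψ → ψ ≤ π / 2 →
      0 < min (sin (2 * ψ)) (sin (2 * ω)) → ψ < π / 2 := by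
    intro ω ψ _ _ hψ hpos
    refine lt_of_le_of_ne hψ fun h => ?_
    have := (lt_min_iff.1 hpos).1
    rw [h, mul_div_cancel₀ π two_ne_zero, Real.sin_pi] at this
    exact lt_irrefl _ this
  have h2 : 2 * (β / 2) - 1 = β - 1 := by ring
  rcases lt_or_gt_of_ne hβ1 with hβ | hβ
  · obtain ⟨C, hC, h⟩ := kernel_le_of_lt_half (a := β / 2) (by linarith) (by linarith)
    refine ⟨C, hC, fun ω ψ hω hωψ hψ => ⟨fun _ => ?_, fun h' => absurd h' hβ.not_gt⟩⟩
    have hδ : 0 < ψ - ω := sub_pos.2 hωψ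
    rw [ENNReal.ofReal_rpow_of_pos hδ, ← ENNReal.ofReal_mul hC.le]
    rcases le_or_gt (min (sin (2 * ψ)) (sin (2 * ω))) 0 with hm | hm
    · rw [ENNReal.ofReal_of_nonpos hm, ENNReal.zero_rpow_of_neg (by linarith),
        ENNReal.mul_top (by positivity)]
      exact le_top
    · rw [ENNReal.ofReal_rpow_of_pos hm, ← ENNReal.ofReal_mul (by positivity)]
      have := h ω ψ _ hω hωψ (hsin_min ω ψ hω hωψ hψ hm) hm (min_le_left _ _)
      rw [h2] at this
      exact ENNReal.ofReal_le_ofReal this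
  · obtain ⟨C, hC, h⟩ := kernel_le_of_half_lt (a := β / 2) (by linarith) (by linarith)
    refine ⟨C, hC, fun ω ψ hω hωψ hψ => ⟨fun h' => absurd h' hβ.not_gt, fun _ => ?_⟩⟩
    rcases le_or_gt (min (sin (2 * ψ)) (sin (2 * ω))) 0 with hm | hm
    · rw [ENNReal.ofReal_of_nonpos hm, ENNReal.zero_rpow_of_neg (by linarith),
        ENNReal.mul_top (by positivity)]
      exact le_top
    · rw [ENNReal.ofReal_rpow_of_pos hm, ← ENNReal.ofReal_mul (by positivity)]
      have := h ω ψ _ hω hωψ (hsin_min ω ψ hω hωψ hψ hm) hm (min_le_left _ _)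
      rw [h2] at this
      exact ENNReal.ofReal_le_ofReal this
end
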